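/- arXiv:2112.13821 — 6 statements merged into one kernel-verified Lean document; each statement's English description precedes it below -/
import Mathlib

section
/- Under Assumption 1, the optimal value of the GTRS equals the value of its inf–sup (convex) reformulation: Opt = inf_{x∈ℝⁿ} sup_{γ∈Γ} q(γ,x), where both sides are interpreted as extended-real values. -/
open Matrix Set

/-- The quadratic function `x ↦ xᵀ A x + 2 bᵀ x + c`. -/
noncomputable def quadF {n : ℕ} (A : Matrix (Fin n) (Fin n) ℝ) (b : Fin n → ℝ) (c : ℝ)
    (x : Fin n → ℝ) : ℝ :=
  x ⬝ᵥ (A *ᵥ x) + 2 * (b ⬝ᵥ x) + c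

open Filter Topology

lemma quadF_add_smul {n : ℕ} {A : Matrix (Fin n) (Fin n) ℝ} (hA : A.IsSymm) (b : Fin n → ℝ)
    (c : ℝ) (x v : Fin n → ℝ) (t : ℝ) :
    quadF A b c (x + t • v) =
      quadF A b c x + 2 * t * (x ⬝ᵥ (A *ᵥ v) + b ⬝ᵥ v) + t ^ 2 * (v ⬝ᵥ (A *ᵥ v)) := by
  have h : v ⬝ᵥ (A *ᵥ x) = x ⬝ᵥ (A *ᵥ v) := by
    rw [dotProduct_mulVec, ← mulVec_transpose, hA.eq, dotProduct_comm]
  simp only [quadF, mulVec_add, mulVec_smul, dotProduct_add, add_dotProduct, smul_dotProduct,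
    dotProduct_smul, smul_eq_mul, h]
  ring

/-- A real quadratic polynomial whose constant and leading coefficients have opposite signs has
a nonnegative root. -/
lemma exists_nonneg_root_of_mul_neg {a b c : ℝ} (h : c * a < 0) :
    ∃ t : ℝ, 0 ≤ t ∧ c + b * t + a * t ^ 2 = 0 := by
  have ha : a ≠ 0 := by rintro rfl; simp at h
  have hca : c / a < 0 := by
    have : c / a = c * a / a ^ 2 := by field_simp
    rw [this]
    exact div_neg_of_neg_of_pos h (by positivity)
  set β := b / a with hβ
  set κ := c / a with hκ
  have hb : b = β * a := by rw [hβ]; field_simp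
  have hc : c = κ * a := by rw [hκ]; field_simp
  have hs := Real.sq_sqrt (show 0 ≤ β ^ 2 - 4 * κ by nlinarith [sq_nonneg β])
  have hle : β ≤ √(β ^ 2 - 4 * κ) := Real.le_sqrt_of_sq_le (by linarith)
  refine ⟨(-β + √(β ^ 2 - 4 * κ)) / 2, by linarith, ?_⟩
  rw [hb, hc]
  linear_combination a / 4 * hs

/-- Moving along a kernel direction `v` of `A₀ + γ A₁` until the constraint is tight does not
increase the aggregated quadratic. -/
lemma exists_quadF_eq_zero_of_kernel {n : ℕ} {A₀ A₁ : Matrix (Fin n) (Fin n) ℝ}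
    (hA₀ : A₀.IsSymm) (hA₁ : A₁.IsSymm) (b₀ b₁ : Fin n → ℝ) (c₀ c₁ : ℝ) {γ : ℝ}
    {v : Fin n → ℝ} (hv : (A₀ + γ • A₁) *ᵥ v = 0) {x : Fin n → ℝ}
    (hx : quadF A₁ b₁ c₁ x * (v ⬝ᵥ (A₁ *ᵥ v)) < 0) :
    ∃ y, quadF A₁ b₁ c₁ y = 0 ∧ quadF A₀ b₀ c₀ y ≤ quadF A₀ b₀ c₀ x + γ * quadF A₁ b₁ c₁ x := by
  wlog hs : b₀ ⬝ᵥ v + γ * (b₁ ⬝ᵥ v) ≤ 0 generalizing v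
  · refine this (v := -v) (by rw [mulVec_neg, hv, neg_zero]) (by simpa [mulVec_neg] using hx) ?_
    simp only [dotProduct_neg]
    linarith
  obtain ⟨t, ht, hroot⟩ :=
    exists_nonneg_root_of_mul_neg (b := 2 * (x ⬝ᵥ (A₁ *ᵥ v) + b₁ ⬝ᵥ v)) hx
  have hy : quadF A₁ b₁ c₁ (x + t • v) = 0 := by
    rw [quadF_add_smul hA₁]
    linarith
  refine ⟨x + t • v, hy, ?_⟩
  have hker (w : Fin n → ℝ) : w ⬝ᵥ (A₀ *ᵥ v) + γ * (w ⬝ᵥ (A₁ *ᵥ v)) = 0 := by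
    have := congrArg (w ⬝ᵥ ·) hv
    simpa [add_mulVec, smul_mulVec, dotProduct_add, dotProduct_smul] using this
  have hadd : quadF A₀ b₀ c₀ (x + t • v) + γ * quadF A₁ b₁ c₁ (x + t • v) =
      quadF A₀ b₀ c₀ x + γ * quadF A₁ b₁ c₁ x + 2 * t * (b₀ ⬝ᵥ v + γ * (b₁ ⬝ᵥ v)) := by
    rw [quadF_add_smul hA₀, quadF_add_smul hA₁]
    linear_combination 2 * t * hker x + t ^ 2 * hker v
  rw [hy] at hadd
  nlinarith

lemma dotProduct_add_smul_mulVec {n : ℕ} (A₀ A₁ : Matrix (Fin n) (Fin n) ℝ) (γ : ℝ)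
    (v : Fin n → ℝ) :
    v ⬝ᵥ ((A₀ + γ • A₁) *ᵥ v) = v ⬝ᵥ (A₀ *ᵥ v) + γ * (v ⬝ᵥ (A₁ *ᵥ v)) := by
  simp [add_mulVec, smul_mulVec, dotProduct_add, dotProduct_smul]

lemma posSemidef_add_smul_iff {n : ℕ} {A₀ A₁ : Matrix (Fin n) (Fin n) ℝ}
    (hA₀ : A₀.IsSymm) (hA₁ : A₁.IsSymm) (γ : ℝ) :
    (A₀ + γ • A₁).PosSemidef ↔ ∀ v, 0 ≤ v ⬝ᵥ (A₀ *ᵥ v) + γ * (v ⬝ᵥ (A₁ *ᵥ v)) := by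
  rw [posSemidef_iff_dotProduct_mulVec,
    and_iff_right (isHermitian_iff_isSymm.2 (hA₀.add (hA₁.smul γ)))]
  simp only [star_trivial, dotProduct_add_smul_mulVec]

lemma isClosed_setOf_posSemidef_add_smul {n : ℕ} {A₀ A₁ : Matrix (Fin n) (Fin n) ℝ}
    (hA₀ : A₀.IsSymm) (hA₁ : A₁.IsSymm) :
    IsClosed {γ : ℝ | 0 ≤ γ ∧ (A₀ + γ • A₁).PosSemidef} := by
  simp only [posSemidef_add_smul_iff hA₀ hA₁, ofPred_and, ofPred_forall]
  exact isClosed_Ici.inter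
    (isClosed_iInter fun v => isClosed_le continuous_const (by fun_prop))

lemma eventually_posSemidef_add_smul {n : ℕ} {A₀ A₁ : Matrix (Fin n) (Fin n) ℝ}
    (hA₀ : A₀.IsSymm) (hA₁ : A₁.IsSymm) {γ : ℝ} (h : (A₀ + γ • A₁).PosDef) :
    ∀ᶠ γ' in 𝓝 γ, (A₀ + γ' • A₁).PosSemidef := by
  have hcont : Continuous fun p : ℝ × (Fin n → ℝ) =>
      p.2 ⬝ᵥ (A₀ *ᵥ p.2) + p.1 * (p.2 ⬝ᵥ (A₁ *ᵥ p.2)) := by fun_prop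
  have hev := (isCompact_sphere (0 : Fin n → ℝ) 1).eventually_forall_of_forall_eventually
    (x₀ := γ) (P := fun γ' v => 0 < v ⬝ᵥ (A₀ *ᵥ v) + γ' * (v ⬝ᵥ (A₁ *ᵥ v))) (by
      intro v hv
      refine hcont.continuousAt.eventually (lt_mem_nhds ?_)
      have := h.dotProduct_mulVec_pos (x := v) (by rintro rfl; simp at hv)
      rwa [star_trivial, dotProduct_add_smul_mulVec] at this)
  filter_upwards [hev] with γ' hγ'
  rw [posSemidef_add_smul_iff hA₀ hA₁]
  intro v
  rcases eq_or_ne v 0 with rfl | hv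
  · simp
  have hv' : ‖v‖ ≠ 0 := norm_ne_zero_iff.2 hv
  have := hγ' (‖v‖⁻¹ • v) (by simp [norm_smul, hv'])
  simp only [mulVec_smul, smul_dotProduct, dotProduct_smul, smul_eq_mul] at this
  have hpos : 0 < ‖v‖⁻¹ * ‖v‖⁻¹ := by positivity
  refine (pos_of_mul_pos_right (b := v ⬝ᵥ (A₀ *ᵥ v) + γ' * (v ⬝ᵥ (A₁ *ᵥ v))) ?_ hpos.le).le
  linarith

lemma exists_kernel_of_not_posDef {n : ℕ} {A₀ A₁ : Matrix (Fin n) (Fin n) ℝ} {γ : ℝ}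
    (h : (A₀ + γ • A₁).PosSemidef) (hn : ¬ (A₀ + γ • A₁).PosDef) {γbar : ℝ}
    (hpd : (A₀ + γbar • A₁).PosDef) :
    ∃ v, (A₀ + γ • A₁) *ᵥ v = 0 ∧ 0 < (γbar - γ) * (v ⬝ᵥ (A₁ *ᵥ v)) := by
  have : ∃ v, v ≠ 0 ∧ (A₀ + γ • A₁) *ᵥ v = 0 := by
    by_contra! hker
    refine hn (.of_dotProduct_mulVec_pos h.isHermitian fun v hv => ?_)
    exact (h.dotProduct_mulVec_nonneg v).lt_of_ne' fun h0 =>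
      hker v hv ((h.dotProduct_mulVec_zero_iff v).1 h0)
  obtain ⟨v, hv, hv0⟩ := this
  refine ⟨v, hv0, ?_⟩
  have h1 := hpd.dotProduct_mulVec_pos hv
  have h2 : v ⬝ᵥ ((A₀ + γ • A₁) *ᵥ v) = 0 := by rw [hv0, dotProduct_zero]
  rw [star_trivial, dotProduct_add_smul_mulVec] at h1
  rw [dotProduct_add_smul_mulVec] at h2
  linarith

/-- Under Assumption 1, the optimal value of the GTRS equals the value of its
inf–sup (convex) reformulation, both sides being extended reals. -/
theorem stmt_0 {n : ℕ} (hn : 0 < n)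
    (A₀ A₁ : Matrix (Fin n) (Fin n) ℝ) (hA₀ : A₀.IsSymm) (hA₁ : A₁.IsSymm)
    (b₀ b₁ : Fin n → ℝ) (c₀ c₁ : ℝ)
    (xbar : Fin n → ℝ) (hxbar : quadF A₁ b₁ c₁ xbar < 0)
    (γbar : ℝ) (hγbar : 0 ≤ γbar) (hpd : (A₀ + γbar • A₁).PosDef) :
    sInf ((fun x : Fin n → ℝ => ((quadF A₀ b₀ c₀ x : ℝ) : EReal)) ''
        {x : Fin n → ℝ | quadF A₁ b₁ c₁ x ≤ 0}) =
      ⨅ x : Fin n → ℝ, ⨆ γ ∈ {γ : ℝ | 0 ≤ γ ∧ (A₀ + γ • A₁).PosSemidef},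
        ((quadF A₀ b₀ c₀ x + γ * quadF A₁ b₁ c₁ x : ℝ) : EReal) := by
  set Γ := {γ : ℝ | 0 ≤ γ ∧ (A₀ + γ • A₁).PosSemidef}
  have hbar : γbar ∈ Γ := ⟨hγbar, hpd.posSemidef⟩
  have hclosed : IsClosed Γ := isClosed_setOf_posSemidef_add_smul hA₀ hA₁
  apply le_antisymm
  · refine le_iInf fun x => ?_
    have key {γ : ℝ} (hγ : γ ∈ Γ) {y : Fin n → ℝ} (hy : quadF A₁ b₁ c₁ y ≤ 0)
        (hle : quadF A₀ b₀ c₀ y ≤ quadF A₀ b₀ c₀ x + γ * quadF A₁ b₁ c₁ x) :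
        sInf ((fun x : Fin n → ℝ => ((quadF A₀ b₀ c₀ x : ℝ) : EReal)) ''
          {x : Fin n → ℝ | quadF A₁ b₁ c₁ x ≤ 0}) ≤
        ⨆ γ ∈ Γ, ((quadF A₀ b₀ c₀ x + γ * quadF A₁ b₁ c₁ x : ℝ) : EReal) :=
      le_trans (sInf_le ⟨y, hy, rfl⟩) <| (EReal.coe_le_coe_iff.2 hle).trans <|
        le_iSup₂ (f := fun γ (_ : γ ∈ Γ) =>
          ((quadF A₀ b₀ c₀ x + γ * quadF A₁ b₁ c₁ x : ℝ) : EReal)) γ hγ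
    rcases lt_trichotomy (quadF A₁ b₁ c₁ x) 0 with hx | hx | hx
    · have hbdd : BddBelow Γ := ⟨0, fun γ hγ => hγ.1⟩
      have hmem : sInf Γ ∈ Γ := hclosed.csInf_mem ⟨γbar, hbar⟩ hbdd
      rcases hmem.1.eq_or_lt with h0 | hpos
      · exact key hmem hx.le (by simp [← h0])
      have hnpd : ¬ (A₀ + sInf Γ • A₁).PosDef := by
        intro h
        obtain ⟨γ, ⟨hγ, hγ0⟩, hlt⟩ := (((eventually_posSemidef_add_smul hA₀ hA₁ h).and
          (lt_mem_nhds hpos)).filter_mono nhdsWithin_le_nhds |>.and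
            (self_mem_nhdsWithin (s := Iio (sInf Γ)))).exists
        exact absurd (csInf_le hbdd ⟨hγ0.le, hγ⟩) (not_le.2 hlt)
      obtain ⟨v, hv, hsgn⟩ := exists_kernel_of_not_posDef hmem.2 hnpd hpd
      have := csInf_le hbdd hbar
      have hvpos := pos_of_mul_pos_right hsgn (sub_nonneg.2 this)
      obtain ⟨y, hy, hle⟩ := exists_quadF_eq_zero_of_kernel hA₀ hA₁ b₀ b₁ c₀ c₁ hv
        (mul_neg_of_neg_of_pos hx hvpos)
      exact key hmem hy.le hle
    · exact key hbar hx.le (by simp [hx])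
    · by_cases hbdd : BddAbove Γ
      · have hmem : sSup Γ ∈ Γ := hclosed.csSup_mem ⟨γbar, hbar⟩ hbdd
        have hnpd : ¬ (A₀ + sSup Γ • A₁).PosDef := by
          intro h
          obtain ⟨γ, hγ, hlt⟩ := ((eventually_posSemidef_add_smul hA₀ hA₁ h).filter_mono
            nhdsWithin_le_nhds |>.and (self_mem_nhdsWithin (s := Ioi (sSup Γ)))).exists
          exact absurd (le_csSup hbdd ⟨hmem.1.trans (le_of_lt hlt), hγ⟩) (not_le.2 hlt)
        obtain ⟨v, hv, hsgn⟩ := exists_kernel_of_not_posDef hmem.2 hnpd hpd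
        have := le_csSup hbdd hbar
        have hvneg : v ⬝ᵥ (A₁ *ᵥ v) < 0 := by
          by_contra! hnn
          nlinarith
        obtain ⟨y, hy, hle⟩ := exists_quadF_eq_zero_of_kernel hA₀ hA₁ b₀ b₁ c₀ c₁ hv
          (mul_neg_of_pos_of_neg hx hvneg)
        exact key hmem hy.le hle
      · obtain ⟨γ, hγ, hlt⟩ := not_bddAbove_iff.1 hbdd
          ((quadF A₀ b₀ c₀ xbar - quadF A₀ b₀ c₀ x) / quadF A₁ b₁ c₁ x)
        rw [div_lt_iff₀ hx] at hlt
        exact key hγ hxbar.le (by linarith)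
  · refine le_sInf ?_
    rintro _ ⟨x, hx, rfl⟩
    refine iInf_le_of_le x (iSup₂_le fun γ hγ => EReal.coe_le_coe_iff.2 ?_)
    have := mul_nonpos_of_nonneg_of_nonpos hγ.1 hx
    linarith
end

section
/- Suppose γ ∈ ℝ and A(γ) is positive definite. Then the infimum d(γ) = inf_{x∈ℝⁿ} q(γ,x) is attained at x(γ) = −A(γ)⁻¹b(γ), so d(γ) = q(γ, x(γ)); moreover the real-valued function γ' ↦ q(γ', x(γ')) (which on the open set {γ' : A(γ') positive definite} equals γ' ↦ inf_{x} q(γ',x)) is differentiable at γ with derivative ν(γ) = q₁(x(γ)). -/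
open Matrix Set

/-- `x(γ) = −A(γ)⁻¹ b(γ)`. -/
noncomputable def xOf {n : ℕ} (A₀ A₁ : Matrix (Fin n) (Fin n) ℝ) (b₀ b₁ : Fin n → ℝ)
    (γ : ℝ) : Fin n → ℝ :=
  -((A₀ + γ • A₁)⁻¹ *ᵥ (b₀ + γ • b₁))

open Filter Topology

/-- The pencil of two quadratic functions is the quadratic function of the pencils. -/
lemma quadF_add_mul_quadF {n : ℕ} (A₀ A₁ : Matrix (Fin n) (Fin n) ℝ) (b₀ b₁ : Fin n → ℝ)
    (c₀ c₁ γ : ℝ) (x : Fin n → ℝ) :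
    quadF A₀ b₀ c₀ x + γ * quadF A₁ b₁ c₁ x =
      quadF (A₀ + γ • A₁) (b₀ + γ • b₁) (c₀ + γ * c₁) x := by
  simp only [quadF, add_mulVec, smul_mulVec, dotProduct_add, add_dotProduct, dotProduct_smul,
    smul_dotProduct, smul_eq_mul]
  ring

/-- Completing the square around a critical point `y`. -/
lemma quadF_eq_add_of_mulVec_eq_neg {n : ℕ} {A : Matrix (Fin n) (Fin n) ℝ} (hA : A.IsSymm)
    {b y : Fin n → ℝ} (c : ℝ) (hy : A *ᵥ y = -b) (z : Fin n → ℝ) :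
    quadF A b c z = quadF A b c y + (z - y) ⬝ᵥ (A *ᵥ (z - y)) := by
  have hyz : y ⬝ᵥ (A *ᵥ z) = -(b ⬝ᵥ z) := by
    rw [dotProduct_mulVec, ← mulVec_transpose, hA.eq, hy, neg_dotProduct]
  simp only [quadF, mulVec_sub, sub_dotProduct, dotProduct_sub, hyz, hy, dotProduct_neg,
    dotProduct_comm _ b]
  ring

/-- `x(γ)` is a critical point of `q(γ, ·)` when `A(γ)` is invertible. -/
lemma mulVec_xOf {n : ℕ} {A₀ A₁ : Matrix (Fin n) (Fin n) ℝ} (b₀ b₁ : Fin n → ℝ) {γ : ℝ}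
    (h : (A₀ + γ • A₁).det ≠ 0) :
    (A₀ + γ • A₁) *ᵥ xOf A₀ A₁ b₀ b₁ γ = -(b₀ + γ • b₁) := by
  rw [xOf, mulVec_neg, mulVec_mulVec, mul_nonsing_inv _ h.isUnit, one_mulVec]

lemma continuousAt_xOf {n : ℕ} {A₀ A₁ : Matrix (Fin n) (Fin n) ℝ} (b₀ b₁ : Fin n → ℝ) {γ : ℝ}
    (h : (A₀ + γ • A₁).det ≠ 0) : ContinuousAt (xOf A₀ A₁ b₀ b₁) γ := by
  have hA : ContinuousAt (fun t : ℝ => (A₀ + t • A₁)⁻¹) γ := by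
    refine ContinuousAt.comp (f := fun t : ℝ => A₀ + t • A₁) (g := Inv.inv)
      (continuousAt_matrix_inv _ ?_) (by fun_prop)
    rw [Ring.inverse_eq_inv']
    exact continuousAt_inv₀ h
  have hmul : Continuous fun p : Matrix (Fin n) (Fin n) ℝ × (Fin n → ℝ) => -(p.1 *ᵥ p.2) :=
    (continuous_fst.matrix_mulVec continuous_snd).neg
  have hb : ContinuousAt (fun t : ℝ => b₀ + t • b₁) γ := by fun_prop
  exact hmul.continuousAt.comp (hA.prodMk hb)

/-- If `A(γ)` is positive definite then `inf_x q(γ,x)` is attained at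
`x(γ) = −A(γ)⁻¹b(γ)` (so `d(γ) = q(γ, x(γ))`), and `γ' ↦ q(γ', x(γ'))` is differentiable at `γ`
with derivative `ν(γ) = q₁(x(γ))`. -/
theorem stmt_4 {n : ℕ} (hn : 0 < n)
    (A₀ A₁ : Matrix (Fin n) (Fin n) ℝ) (hA₀ : A₀.IsSymm) (hA₁ : A₁.IsSymm)
    (b₀ b₁ : Fin n → ℝ) (c₀ c₁ : ℝ)
    (γ : ℝ) (hpd : (A₀ + γ • A₁).PosDef) :
    IsLeast (Set.range fun x : Fin n → ℝ => quadF A₀ b₀ c₀ x + γ * quadF A₁ b₁ c₁ x)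
      (quadF A₀ b₀ c₀ (xOf A₀ A₁ b₀ b₁ γ) + γ * quadF A₁ b₁ c₁ (xOf A₀ A₁ b₀ b₁ γ)) ∧
    HasDerivAt (fun γ' : ℝ =>
        quadF A₀ b₀ c₀ (xOf A₀ A₁ b₀ b₁ γ') + γ' * quadF A₁ b₁ c₁ (xOf A₀ A₁ b₀ b₁ γ'))
      (quadF A₁ b₁ c₁ (xOf A₀ A₁ b₀ b₁ γ)) γ := by
  have hsymm (t : ℝ) : (A₀ + t • A₁).IsSymm := hA₀.add (hA₁.smul t)
  have hdet : (A₀ + γ • A₁).det ≠ 0 := hpd.det_pos.ne'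
  refine ⟨⟨⟨_, rfl⟩, ?_⟩, ?_⟩
  · rintro _ ⟨z, rfl⟩
    simp only [quadF_add_mul_quadF]
    rw [quadF_eq_add_of_mulVec_eq_neg (hsymm γ) _ (mulVec_xOf b₀ b₁ hdet) z]
    exact le_add_of_nonneg_right (hpd.posSemidef.dotProduct_mulVec_nonneg _)
  · set x := xOf A₀ A₁ b₀ b₁ γ with hx
    have hdet' : ∀ᶠ t in 𝓝 γ, (A₀ + t • A₁).det ≠ 0 := by
      have hcont : Continuous fun t : ℝ => (A₀ + t • A₁).det :=
        Continuous.matrix_det (by fun_prop)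
      exact hcont.continuousAt.eventually_ne hdet
    have hlim : Tendsto (fun t => quadF A₁ b₁ c₁ x - (x - xOf A₀ A₁ b₀ b₁ t) ⬝ᵥ (A₁ *ᵥ x + b₁))
        (𝓝 γ) (𝓝 (quadF A₁ b₁ c₁ x)) := by
      have hdot : Continuous fun y => quadF A₁ b₁ c₁ x - (x - y) ⬝ᵥ (A₁ *ᵥ x + b₁) :=
        continuous_const.sub ((continuous_const.sub continuous_id).dotProduct continuous_const)
      simpa [← hx, Function.comp_def] using (hdot.continuousAt.comp (continuousAt_xOf b₀ b₁ hdet)).tendsto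
    rw [hasDerivAt_iff_tendsto_slope]
    refine (hlim.mono_left nhdsWithin_le_nhds).congr' ?_
    filter_upwards [hdet'.filter_mono nhdsWithin_le_nhds, self_mem_nhdsWithin] with t ht htγ
    have hcrit := mulVec_xOf b₀ b₁ ht
    have hsquare := quadF_eq_add_of_mulVec_eq_neg (hsymm t) (c₀ + t * c₁) hcrit x
    have hresidual : (A₀ + t • A₁) *ᵥ (x - xOf A₀ A₁ b₀ b₁ t) = (t - γ) • (A₁ *ᵥ x + b₁) := by
      have hcritγ := mulVec_xOf b₀ b₁ hdet
      rw [← hx, add_mulVec, smul_mulVec] at hcritγ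
      rw [mulVec_sub, hcrit, add_mulVec, smul_mulVec, eq_sub_of_add_eq hcritγ]
      module
    rw [hresidual, dotProduct_smul, smul_eq_mul, ← quadF_add_mul_quadF,
      ← quadF_add_mul_quadF] at hsquare
    rw [slope_def_field, eq_div_iff (sub_ne_zero.mpr htγ), ← hx]
    linear_combination hsquare
end

section
/- Suppose γ ∈ ℝ and A(γ) is positive definite. Then the function ν(γ') = q₁(−A(γ')⁻¹b(γ')), defined on the open set {γ' : A(γ') positive definite}, is differentiable at γ with derivative ν'(γ) = −2(A₁x(γ) + b₁)ᵀ A(γ)⁻¹ (A₁x(γ) + b₁), where x(γ) = −A(γ)⁻¹b(γ). -/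
open Matrix Set

/-- `ν(γ) = q₁(x(γ))`. -/
noncomputable def nuF {n : ℕ} (A₀ A₁ : Matrix (Fin n) (Fin n) ℝ) (b₀ b₁ : Fin n → ℝ)
    (c₁ : ℝ) (γ : ℝ) : ℝ :=
  quadF A₁ b₁ c₁ (xOf A₀ A₁ b₀ b₁ γ)

/-- The difference quotient of `xOf` is exact as long as both matrices are invertible. -/
theorem xOf_sub_xOf {n : ℕ} {A₀ A₁ : Matrix (Fin n) (Fin n) ℝ} {b₀ b₁ : Fin n → ℝ} {γ γ' : ℝ}
    (h : IsUnit (A₀ + γ • A₁).det) (h' : IsUnit (A₀ + γ' • A₁).det) :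
    xOf A₀ A₁ b₀ b₁ γ' - xOf A₀ A₁ b₀ b₁ γ =
      (γ' - γ) • -((A₀ + γ' • A₁)⁻¹ *ᵥ (A₁ *ᵥ xOf A₀ A₁ b₀ b₁ γ + b₁)) := by
  have key : ∀ {t : ℝ}, IsUnit (A₀ + t • A₁).det →
      (A₀ + t • A₁) *ᵥ xOf A₀ A₁ b₀ b₁ t = -(b₀ + t • b₁) := by
    intro t ht
    rw [xOf, mulVec_neg, mulVec_mulVec, mul_nonsing_inv _ ht, one_mulVec]
  apply Matrix.mulVec_injective_of_isUnit ((Matrix.isUnit_iff_isUnit_det _).2 h')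
  have hx := key h
  simp only [mulVec_sub, key h', mulVec_smul, mulVec_neg, mulVec_mulVec,
    mul_nonsing_inv _ h', one_mulVec]
  simp only [add_mulVec, smul_mulVec] at hx ⊢
  linear_combination (norm := module) -hx

theorem hasDerivAt_xOf {n : ℕ} {A₀ A₁ : Matrix (Fin n) (Fin n) ℝ} {b₀ b₁ : Fin n → ℝ} {γ : ℝ}
    (h : IsUnit (A₀ + γ • A₁).det) :
    HasDerivAt (xOf A₀ A₁ b₀ b₁)
      (-((A₀ + γ • A₁)⁻¹ *ᵥ (A₁ *ᵥ xOf A₀ A₁ b₀ b₁ γ + b₁))) γ := by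
  have hpath : Continuous fun t : ℝ => A₀ + t • A₁ := by fun_prop
  have hunit : ∀ᶠ t in nhds γ, IsUnit (A₀ + t • A₁).det := by
    simp only [isUnit_iff_ne_zero] at h ⊢
    exact hpath.matrix_det.continuousAt.eventually_ne h
  have hinv : ContinuousAt (fun t : ℝ => (A₀ + t • A₁)⁻¹) γ :=
    (continuousAt_matrix_inv _ (by
      simpa only [Ring.inverse_eq_inv'] using continuousAt_inv₀ h.ne_zero)).comp
      (f := fun t : ℝ => A₀ + t • A₁) hpath.continuousAt
  have hmul : Continuous fun B : Matrix (Fin n) (Fin n) ℝ =>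
      -(B *ᵥ (A₁ *ᵥ xOf A₀ A₁ b₀ b₁ γ + b₁)) :=
    (continuous_id.matrix_mulVec continuous_const).neg
  rw [hasDerivAt_iff_tendsto_slope]
  refine Filter.Tendsto.congr' ?_
    ((hmul.continuousAt.comp hinv).tendsto.mono_left nhdsWithin_le_nhds)
  filter_upwards [hunit.filter_mono nhdsWithin_le_nhds, self_mem_nhdsWithin] with t ht hne
  rw [slope_def_module, xOf_sub_xOf h ht, smul_smul, inv_mul_cancel₀ (sub_ne_zero.2 hne), one_smul]
  rfl

theorem HasDerivAt.dotProduct {n : ℕ} {u v : ℝ → Fin n → ℝ} {u' v' : Fin n → ℝ} {t : ℝ}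
    (hu : HasDerivAt u u' t) (hv : HasDerivAt v v' t) :
    HasDerivAt (fun s => u s ⬝ᵥ v s) (u' ⬝ᵥ v t + u t ⬝ᵥ v') t := by
  simp only [_root_.dotProduct, ← Finset.sum_add_distrib]
  exact HasDerivAt.fun_sum fun i _ => (hasDerivAt_pi.1 hu i).mul (hasDerivAt_pi.1 hv i)

theorem HasDerivAt.matrix_mulVec {n : ℕ} (A : Matrix (Fin n) (Fin n) ℝ) {u : ℝ → Fin n → ℝ}
    {u' : Fin n → ℝ} {t : ℝ} (hu : HasDerivAt u u' t) :
    HasDerivAt (fun s => A *ᵥ u s) (A *ᵥ u') t :=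
  A.mulVecLin.toContinuousLinearMap.hasFDerivAt.comp_hasDerivAt t hu

theorem HasDerivAt.quadF {n : ℕ} {A : Matrix (Fin n) (Fin n) ℝ} (hA : A.IsSymm) (b : Fin n → ℝ)
    (c : ℝ) {u : ℝ → Fin n → ℝ} {u' : Fin n → ℝ} {t : ℝ} (hu : HasDerivAt u u' t) :
    HasDerivAt (fun s => _root_.quadF A b c (u s)) (2 * ((A *ᵥ u t + b) ⬝ᵥ u')) t := by
  have hsymm : u t ⬝ᵥ (A *ᵥ u') = (A *ᵥ u t) ⬝ᵥ u' := by
    rw [dotProduct_mulVec, ← mulVec_transpose, hA.eq]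
  have hlin := (hasDerivAt_const t b).dotProduct hu
  refine (((hu.dotProduct (hu.matrix_mulVec A)).add (hlin.const_mul 2)).add_const c).congr_deriv ?_
  rw [hsymm, dotProduct_comm u', zero_dotProduct, add_dotProduct]
  ring

/-- If `A(γ)` is positive definite then `ν` is differentiable at `γ` with
`ν'(γ) = −2(A₁x(γ) + b₁)ᵀ A(γ)⁻¹ (A₁x(γ) + b₁)`. -/
theorem stmt_7 {n : ℕ} (hn : 0 < n)
    (A₀ A₁ : Matrix (Fin n) (Fin n) ℝ) (hA₀ : A₀.IsSymm) (hA₁ : A₁.IsSymm)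
    (b₀ b₁ : Fin n → ℝ) (c₀ c₁ : ℝ)
    (γ : ℝ) (hpd : (A₀ + γ • A₁).PosDef) :
    HasDerivAt (nuF A₀ A₁ b₀ b₁ c₁)
      (-2 * ((A₁ *ᵥ xOf A₀ A₁ b₀ b₁ γ + b₁) ⬝ᵥ
        ((A₀ + γ • A₁)⁻¹ *ᵥ (A₁ *ᵥ xOf A₀ A₁ b₀ b₁ γ + b₁)))) γ := by
  refine ((hasDerivAt_xOf hpd.det_pos.ne'.isUnit).quadF hA₁ b₁ c₁).congr_deriv ?_
  rw [dotProduct_neg]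
  ring
end

section
/- Suppose Assumption 1 holds, the spectral norms satisfy ‖A₀‖, ‖A₁‖ ≤ 1, ‖b₀‖, ‖b₁‖ ≤ 1, |c₀|, |c₁| ≤ 1, Γ ⊆ [0, ζ] with ζ ≥ 1, μ ∈ (0,1], ε ∈ (0,1), and γ ≥ 0 satisfies A(γ) ⪰ μI. If x̃ ∈ ℝⁿ satisfies ‖x̃ − x(γ)‖ ≤ με/(40ζ²) and q₁(x̃) ∈ [−ε/(4ζ), ε/(4ζ)], then x̃ is an ε-approximate solution of the GTRS: q₀(x̃) ≤ Opt + ε and q₁(x̃) ≤ ε. -/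
open Matrix Set

/-- Euclidean norm of a vector in `ℝⁿ`. -/
noncomputable def eNorm {n : ℕ} (x : Fin n → ℝ) : ℝ :=
  Real.sqrt (x ⬝ᵥ x)

/-- Spectral (ℓ²-operator) norm of a matrix. -/
noncomputable def sNorm {n : ℕ} (A : Matrix (Fin n) (Fin n) ℝ) : ℝ :=
  ‖Matrix.toEuclideanCLM (𝕜 := ℝ) A‖

theorem norm_toLp_eq_eNorm {n : ℕ} (x : Fin n → ℝ) : ‖WithLp.toLp 2 x‖ = eNorm x := by
  rw [EuclideanSpace.norm_eq, eNorm]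
  simp [dotProduct, sq]

/-- A quadratic form is bounded by the spectral norm of its matrix. -/
theorem dotProduct_mulVec_le_sNorm_mul {n : ℕ} (A : Matrix (Fin n) (Fin n) ℝ) (x : Fin n → ℝ) :
    x ⬝ᵥ (A *ᵥ x) ≤ sNorm A * eNorm x ^ 2 := by
  have h := real_inner_le_norm (Matrix.toEuclideanCLM (𝕜 := ℝ) A (WithLp.toLp 2 x))
    (WithLp.toLp 2 x)
  have hop := (Matrix.toEuclideanCLM (𝕜 := ℝ) A).le_opNorm (WithLp.toLp 2 x)
  have hinner : inner ℝ (Matrix.toEuclideanCLM (𝕜 := ℝ) A (WithLp.toLp 2 x)) (WithLp.toLp 2 x)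
      = x ⬝ᵥ (A *ᵥ x) := by
    rw [Matrix.toEuclideanCLM_toLp, EuclideanSpace.inner_toLp_toLp]
    simp
  rw [hinner] at h
  rw [norm_toLp_eq_eNorm x] at h hop
  have h0 : 0 ≤ eNorm x := Real.sqrt_nonneg _
  rw [sNorm]
  nlinarith [mul_le_mul_of_nonneg_right hop h0]

/-- The Lagrangian `q₀ + γ q₁` is the quadratic with the combined data. -/
theorem quadF_add_smul_s12 {n : ℕ} (A₀ A₁ : Matrix (Fin n) (Fin n) ℝ) (b₀ b₁ : Fin n → ℝ)
    (c₀ c₁ γ : ℝ) (x : Fin n → ℝ) :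
    quadF (A₀ + γ • A₁) (b₀ + γ • b₁) (c₀ + γ * c₁) x
      = quadF A₀ b₀ c₀ x + γ * quadF A₁ b₁ c₁ x := by
  simp only [quadF, add_mulVec, smul_mulVec, dotProduct_add, add_dotProduct, dotProduct_smul,
    smul_dotProduct, smul_eq_mul]
  ring

/-- Expansion of a quadratic around a stationary point. -/
theorem quadF_eq_of_mulVec_eq_neg {n : ℕ} {A : Matrix (Fin n) (Fin n) ℝ} (hA : A.IsSymm)
    {b w : Fin n → ℝ} (hw : A *ᵥ w = -b) (c : ℝ) (x : Fin n → ℝ) :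
    quadF A b c x = quadF A b c w + (x - w) ⬝ᵥ (A *ᵥ (x - w)) := by
  have hb : b = -(A *ᵥ w) := by rw [hw, neg_neg]
  have hcomm : w ⬝ᵥ (A *ᵥ x) = x ⬝ᵥ (A *ᵥ w) := by
    rw [dotProduct_mulVec, ← mulVec_transpose, hA.eq, dotProduct_comm]
  subst hb
  simp only [quadF, mulVec_sub, dotProduct_sub, sub_dotProduct, neg_dotProduct, hcomm,
    dotProduct_comm (A *ᵥ w)]
  ring

/-- Under Assumption 1 and the stated normalizations, a point `x̃` close to
`x(γ)` whose constraint value `q₁(x̃)` is within `ε/(4ζ)` of zero is an `ε`-approximate solution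
of the GTRS. -/
theorem stmt_12 {n : ℕ} (hn : 0 < n)
    (A₀ A₁ : Matrix (Fin n) (Fin n) ℝ) (hA₀ : A₀.IsSymm) (hA₁ : A₁.IsSymm)
    (b₀ b₁ : Fin n → ℝ) (c₀ c₁ : ℝ)
    (xbar : Fin n → ℝ) (hxbar : quadF A₁ b₁ c₁ xbar < 0)
    (γbar : ℝ) (hγbar : 0 ≤ γbar) (hpdbar : (A₀ + γbar • A₁).PosDef)
    (hA₀n : sNorm A₀ ≤ 1) (hA₁n : sNorm A₁ ≤ 1)
    (hb₀n : eNorm b₀ ≤ 1) (hb₁n : eNorm b₁ ≤ 1)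
    (hc₀ : |c₀| ≤ 1) (hc₁ : |c₁| ≤ 1)
    (ζ : ℝ) (hζ : 1 ≤ ζ)
    (hΓ : {γ : ℝ | 0 ≤ γ ∧ (A₀ + γ • A₁).PosSemidef} ⊆ Set.Icc 0 ζ)
    (μ : ℝ) (hμ0 : 0 < μ) (hμ1 : μ ≤ 1)
    (ε : ℝ) (hε0 : 0 < ε) (hε1 : ε < 1)
    (γ : ℝ) (hγ0 : 0 ≤ γ)
    (hAγ : ((A₀ + γ • A₁) - μ • (1 : Matrix (Fin n) (Fin n) ℝ)).PosSemidef)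
    (xt : Fin n → ℝ)
    (hxt : eNorm (xt - xOf A₀ A₁ b₀ b₁ γ) ≤ μ * ε / (40 * ζ ^ 2))
    (hq₁xt : quadF A₁ b₁ c₁ xt ∈ Set.Icc (-(ε / (4 * ζ))) (ε / (4 * ζ))) :
    quadF A₀ b₀ c₀ xt ≤
      sInf (quadF A₀ b₀ c₀ '' {x : Fin n → ℝ | quadF A₁ b₁ c₁ x ≤ 0}) + ε ∧
    quadF A₁ b₁ c₁ xt ≤ ε := by
  obtain ⟨hq_lo, hq_hi⟩ := hq₁xt
  have hζ0 : 0 < ζ := by linarith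
  have hpd : (A₀ + γ • A₁).PosDef := by
    have h : (μ • (1 : Matrix (Fin n) (Fin n) ℝ)).PosDef := Matrix.PosDef.one.smul hμ0
    simpa using Matrix.PosDef.posSemidef_add hAγ h
  have hγζ : γ ≤ ζ := (hΓ ⟨hγ0, hpd.posSemidef⟩).2
  have hsymm : (A₀ + γ • A₁).IsSymm := hA₀.add (hA₁.smul γ)
  have hdet : IsUnit (A₀ + γ • A₁).det := hpd.det_pos.ne'.isUnit
  set w := xOf A₀ A₁ b₀ b₁ γ with hw_def
  have hw : (A₀ + γ • A₁) *ᵥ w = -(b₀ + γ • b₁) := by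
    rw [hw_def, xOf, mulVec_neg, mulVec_mulVec, Matrix.mul_nonsing_inv _ hdet, one_mulVec]
  have hexp := quadF_eq_of_mulVec_eq_neg hsymm hw (c₀ + γ * c₁)
  have hclose : (xt - w) ⬝ᵥ ((A₀ + γ • A₁) *ᵥ (xt - w)) ≤ ε / 2 := by
    have h0 := dotProduct_mulVec_le_sNorm_mul A₀ (xt - w)
    have h1 := dotProduct_mulVec_le_sNorm_mul A₁ (xt - w)
    have hd0 : 0 ≤ eNorm (xt - w) := Real.sqrt_nonneg _
    have hd : ζ * eNorm (xt - w) ≤ ε / 40 := by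
      calc ζ * eNorm (xt - w) ≤ ζ * (μ * ε / (40 * ζ ^ 2)) := by gcongr
        _ = μ * ε / (40 * ζ) := by field_simp
        _ ≤ 1 * ε / (40 * 1) := by gcongr
        _ = ε / 40 := by ring
    have hd1 : eNorm (xt - w) ≤ 1 := by nlinarith
    have h0' : (xt - w) ⬝ᵥ (A₀ *ᵥ (xt - w)) ≤ eNorm (xt - w) ^ 2 := by
      nlinarith [mul_le_mul_of_nonneg_right hA₀n (sq_nonneg (eNorm (xt - w)))]
    have h1' : (xt - w) ⬝ᵥ (A₁ *ᵥ (xt - w)) ≤ eNorm (xt - w) ^ 2 := by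
      nlinarith [mul_le_mul_of_nonneg_right hA₁n (sq_nonneg (eNorm (xt - w)))]
    rw [add_mulVec, dotProduct_add, smul_mulVec, dotProduct_smul, smul_eq_mul]
    calc _ ≤ eNorm (xt - w) ^ 2 + γ * eNorm (xt - w) ^ 2 := by gcongr
      _ ≤ ζ * eNorm (xt - w) ^ 2 + ζ * eNorm (xt - w) ^ 2 := by
        have := mul_le_mul_of_nonneg_right hζ (sq_nonneg (eNorm (xt - w)))
        have := mul_le_mul_of_nonneg_right hγζ (sq_nonneg (eNorm (xt - w)))
        linarith
      _ = 2 * (ζ * eNorm (xt - w)) * eNorm (xt - w) := by ring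
      _ ≤ 2 * (ε / 40) * 1 := by gcongr
      _ ≤ ε / 2 := by linarith
  have hγq : -(γ * quadF A₁ b₁ c₁ xt) ≤ ε / 4 := by
    calc -(γ * quadF A₁ b₁ c₁ xt) = γ * -quadF A₁ b₁ c₁ xt := by ring
      _ ≤ γ * (ε / (4 * ζ)) := by gcongr; linarith
      _ ≤ ζ * (ε / (4 * ζ)) := by gcongr
      _ = ε / 4 := by field_simp
  constructor
  · rw [← sub_le_iff_le_add]
    refine le_csInf (Set.Nonempty.image _ ⟨xbar, hxbar.le⟩) ?_
    rintro _ ⟨x, hx, rfl⟩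
    have hnonneg : 0 ≤ (x - w) ⬝ᵥ ((A₀ + γ • A₁) *ᵥ (x - w)) := by
      simpa using hpd.posSemidef.dotProduct_mulVec_nonneg (x - w)
    have hx' := hexp x
    have hxt' := hexp xt
    rw [quadF_add_smul_s12 A₀ A₁ b₀ b₁ c₀ c₁ γ] at hx' hxt'
    have hγx : γ * quadF A₁ b₁ c₁ x ≤ 0 := mul_nonpos_of_nonneg_of_nonpos hγ0 hx
    linarith
  · refine hq_hi.trans (div_le_self hε0.le ?_)
    linarith
end

section
/- Let A₀, A₁ be n×n real symmetric matrices with spectral norm ‖A₁‖ ≤ 1, let ζ ≥ 1, μ ∈ (0,1], γ̂ ∈ ℝ, and let λ, λ̃ ∈ ℝ with λ ≠ 0, |λ| ≥ 1/ζ, and λ̃ ≠ 0. Set γ = γ̂ + 1/λ and γ̃ = γ̂ + 1/λ̃. If λ_min(A₀ + γA₁) = 3μ/4 and |λ − λ̃| ≤ μ/(5ζ²), then λ_min(A₀ + γ̃A₁) ≥ μ/2. -/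
open Matrix Set

/-- The smallest eigenvalue of a real symmetric matrix, characterized as
`λ_min(M) = max {t : M − tI ⪰ 0}` (via `sSup`). -/
noncomputable def lambdaMin {n : ℕ} (M : Matrix (Fin n) (Fin n) ℝ) : ℝ :=
  sSup {t : ℝ | (M - t • (1 : Matrix (Fin n) (Fin n) ℝ)).PosSemidef}

/-- The Euclidean quadratic form of a matrix is bounded by its spectral norm. -/
theorem abs_dotProduct_mulVec_le_sNorm {n : ℕ} (A : Matrix (Fin n) (Fin n) ℝ) (x : Fin n → ℝ) :
    |x ⬝ᵥ A *ᵥ x| ≤ sNorm A * (x ⬝ᵥ x) := by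
  have hinner : inner ℝ (Matrix.toEuclideanCLM (𝕜 := ℝ) A (WithLp.toLp 2 x)) (WithLp.toLp 2 x)
      = x ⬝ᵥ A *ᵥ x := by
    rw [Matrix.toEuclideanCLM_toLp, EuclideanSpace.inner_toLp_toLp, star_trivial]
  have hnorm : ‖WithLp.toLp 2 x‖ * ‖WithLp.toLp 2 x‖ = x ⬝ᵥ x := by
    rw [← real_inner_self_eq_norm_mul_norm, EuclideanSpace.inner_toLp_toLp, star_trivial]
  rw [← hinner, ← hnorm, ← mul_assoc]
  exact (abs_real_inner_le_norm _ _).trans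
    (mul_le_mul_of_nonneg_right (ContinuousLinearMap.le_opNorm _ _) (norm_nonneg _))

theorem posSemidef_smul_add_smul_one {n : ℕ} {A : Matrix (Fin n) (Fin n) ℝ} (hA : A.IsSymm)
    (hAn : sNorm A ≤ 1) {δ c : ℝ} (hδ : |δ| ≤ c) :
    (δ • A + c • (1 : Matrix (Fin n) (Fin n) ℝ)).PosSemidef := by
  refine Matrix.PosSemidef.of_dotProduct_mulVec_nonneg ?_ fun x => ?_
  · rw [Matrix.IsHermitian, Matrix.conjTranspose_eq_transpose_of_trivial]
    simp [hA.eq]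
  · have hx : 0 ≤ x ⬝ᵥ x := by simpa using dotProduct_star_self_nonneg x
    have hform : |δ * (x ⬝ᵥ A *ᵥ x)| ≤ c * (x ⬝ᵥ x) := by
      rw [abs_mul]
      exact mul_le_mul hδ ((abs_dotProduct_mulVec_le_sNorm A x).trans
        (mul_le_of_le_one_left hx hAn)) (abs_nonneg _) ((abs_nonneg δ).trans hδ)
    have hexpand : star x ⬝ᵥ (δ • A + c • (1 : Matrix (Fin n) (Fin n) ℝ)) *ᵥ x
        = δ * (x ⬝ᵥ A *ᵥ x) + c * (x ⬝ᵥ x) := by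
      simp [Matrix.add_mulVec, Matrix.smul_mulVec, dotProduct_add]
    rw [hexpand]
    linarith [neg_le_of_abs_le hform]

theorem bddAbove_posSemidef_sub_smul_one {n : ℕ} (i : Fin n) (M : Matrix (Fin n) (Fin n) ℝ) :
    BddAbove {t : ℝ | (M - t • (1 : Matrix (Fin n) (Fin n) ℝ)).PosSemidef} := by
  refine ⟨M i i, fun t ht => ?_⟩
  have h : 0 ≤ (M - t • (1 : Matrix (Fin n) (Fin n) ℝ)) i i := Matrix.PosSemidef.diag_nonneg ht
  simpa using h

theorem lambdaMin_eq_zero_of_isEmpty (M : Matrix (Fin 0) (Fin 0) ℝ) : lambdaMin M = 0 := by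
  have huniv : {t : ℝ | (M - t • (1 : Matrix (Fin 0) (Fin 0) ℝ)).PosSemidef} = univ := by
    refine eq_univ_of_forall fun t => ?_
    rw [mem_ofPred_eq, Subsingleton.elim (M - t • (1 : Matrix (Fin 0) (Fin 0) ℝ)) 0]
    exact Matrix.PosSemidef.zero
  rw [lambdaMin, huniv, Real.sSup_univ]

/-- If `|δ| ≤ c` and `‖A‖ ≤ 1`, perturbing `M` by `δ • A` lowers `lambdaMin` by at most `c`. -/
theorem lambdaMin_sub_le_lambdaMin_add_smul {n : ℕ} {M A : Matrix (Fin n) (Fin n) ℝ}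
    (hA : A.IsSymm) (hAn : sNorm A ≤ 1) {δ c : ℝ} (hδ : |δ| ≤ c) (hM : lambdaMin M ≠ 0) :
    lambdaMin M - c ≤ lambdaMin (M + δ • A) := by
  obtain _ | k := n
  · exact absurd (lambdaMin_eq_zero_of_isEmpty M) hM
  have hne : {t : ℝ | (M - t • (1 : Matrix (Fin (k + 1)) (Fin (k + 1)) ℝ)).PosSemidef}.Nonempty := by
    by_contra h
    rw [not_nonempty_iff_eq_empty] at h
    exact hM (by rw [lambdaMin, h, Real.sSup_empty])
  rw [sub_le_iff_le_add]
  refine csSup_le hne fun t ht => ?_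
  rw [← sub_le_iff_le_add]
  refine le_csSup (bddAbove_posSemidef_sub_smul_one 0 _) ?_
  have hadd := Matrix.PosSemidef.add ht (posSemidef_smul_add_smul_one hA hAn hδ)
  have hrw : M + δ • A - (t - c) • (1 : Matrix (Fin (k + 1)) (Fin (k + 1)) ℝ)
      = M - t • 1 + (δ • A + c • 1) := by
    rw [sub_smul]
    abel
  rwa [mem_ofPred_eq, hrw]

theorem abs_one_div_sub_one_div_le {ζ μ a b : ℝ} (hζ : 1 ≤ ζ) (hμ1 : μ ≤ 1)
    (ha : 1 / ζ ≤ |a|) (hab : |a - b| ≤ μ / (5 * ζ ^ 2)) :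
    |1 / b - 1 / a| ≤ μ / 4 := by
  have hζ0 : 0 < ζ := by linarith
  have hapos : 0 < |a| := (by positivity : 0 < 1 / ζ).trans_le ha
  have hstep : μ / (5 * ζ ^ 2) ≤ 1 / (5 * ζ) := by
    rw [div_le_div_iff₀ (by positivity) (by positivity)]
    nlinarith
  have hb : 4 / (5 * ζ) ≤ |b| := by
    have hsum : 4 / (5 * ζ) + 1 / (5 * ζ) = 1 / ζ := by
      field_simp
      norm_num
    linarith [abs_sub_abs_le_abs_sub a b]
  have hbpos : 0 < |b| := (by positivity : 0 < 4 / (5 * ζ)).trans_le hb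
  have hμ0 : 0 ≤ μ := by
    have h := (abs_nonneg _).trans hab
    rwa [le_div_iff₀ (by positivity), zero_mul] at h
  have hprod : 1 / ζ * (4 / (5 * ζ)) ≤ |a| * |b| :=
    mul_le_mul ha hb (by positivity) hapos.le
  rw [div_sub_div _ _ (abs_pos.mp hbpos) (abs_pos.mp hapos), abs_div, abs_mul, one_mul, mul_one,
    div_le_iff₀ (by positivity)]
  calc |a - b| ≤ μ / (5 * ζ ^ 2) := hab
    _ = μ / 4 * (1 / ζ * (4 / (5 * ζ))) := by
      field_simp
    _ ≤ μ / 4 * (|b| * |a|) := by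
      rw [mul_comm |b|]
      gcongr

/-- With `γ = γ̂ + 1/λ` and `γ̃ = γ̂ + 1/λ̃`, if
`λ_min(A₀ + γA₁) = 3μ/4` and `|λ − λ̃| ≤ μ/(5ζ²)`, then `λ_min(A₀ + γ̃A₁) ≥ μ/2`. -/
theorem stmt_17 {n : ℕ}
    (A₀ A₁ : Matrix (Fin n) (Fin n) ℝ) (hA₀ : A₀.IsSymm) (hA₁ : A₁.IsSymm)
    (hA₁n : sNorm A₁ ≤ 1)
    (ζ μ γhat lam lamt : ℝ)
    (hζ : 1 ≤ ζ) (hμ0 : 0 < μ) (hμ1 : μ ≤ 1)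
    (hlam : lam ≠ 0) (hlamζ : 1 / ζ ≤ |lam|) (hlamt : lamt ≠ 0)
    (hmin : lambdaMin (A₀ + (γhat + 1 / lam) • A₁) = 3 * μ / 4)
    (hclose : |lam - lamt| ≤ μ / (5 * ζ ^ 2)) :
    μ / 2 ≤ lambdaMin (A₀ + (γhat + 1 / lamt) • A₁) := by
  have hδ := abs_one_div_sub_one_div_le hζ hμ1 hlamζ hclose
  have hpert := lambdaMin_sub_le_lambdaMin_add_smul hA₁ hA₁n hδ
    (M := A₀ + (γhat + 1 / lam) • A₁) (by rw [hmin]; positivity)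
  have hrw : A₀ + (γhat + 1 / lam) • A₁ + (1 / lamt - 1 / lam) • A₁
      = A₀ + (γhat + 1 / lamt) • A₁ := by
    rw [add_assoc, ← add_smul]
    ring_nf
  rw [hrw, hmin] at hpert
  linarith
end

section
/- Let A₀, A₁ be n×n real symmetric matrices with spectral norms ‖A₀‖, ‖A₁‖ ≤ 1, let 0 < ξ ≤ 1 ≤ ζ, γ̂ ∈ [0, ζ] with A(γ̂) = A₀ + γ̂A₁ ⪰ ξI, and μ ∈ (0, ξ). Set δ = μξ²/(360ζ³) and Â = A(γ̂) − (3μ/4)I. Let B, C be symmetric with ‖B‖ ≤ δ‖A₁‖ and ‖C‖ ≤ δ‖Â‖. Suppose λ = max{t ∈ ℝ : −A₁ − tÂ ⪰ 0} satisfies λ ≠ 0, |λ| ≥ 1/ζ, and λ_min(A₀ + (γ̂ + 1/λ)A₁) = 3μ/4. Let λ̃ = max{t ∈ ℝ : (−A₁ + B) − t(Â + C) ⪰ 0}, let ṽ be a unit vector with (−A₁ + B)ṽ = λ̃(Â + C)ṽ, and set γ̃ = γ̂ + 1/λ̃ (λ̃ ≠ 0). Then μ/2 ≤ λ_min(A₀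 + γ̃A₁) ≤ ṽᵀ(A₀ + γ̃A₁)ṽ ≤ μ. -/
open Matrix Set

lemma posSemidef_iff_quadForm {n : ℕ} {M : Matrix (Fin n) (Fin n) ℝ} (hM : M.IsSymm) :
    M.PosSemidef ↔ ∀ x : Fin n → ℝ, 0 ≤ x ⬝ᵥ (M *ᵥ x) := by
  have hH : M.IsHermitian := by
    rwa [Matrix.IsHermitian, Matrix.conjTranspose_eq_transpose_of_trivial]
  constructor
  · intro h x
    simpa using h.dotProduct_mulVec_nonneg x
  · intro h
    exact Matrix.PosSemidef.of_dotProduct_mulVec_nonneg hH (by simpa using h)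

lemma abs_quadForm_le {n : ℕ} (M : Matrix (Fin n) (Fin n) ℝ) (x : Fin n → ℝ) :
    |x ⬝ᵥ (M *ᵥ x)| ≤ sNorm M * (x ⬝ᵥ x) := by
  set y : EuclideanSpace ℝ (Fin n) := WithLp.toLp 2 x with hy
  have h1 : x ⬝ᵥ (M *ᵥ x) = inner ℝ y (Matrix.toEuclideanCLM (𝕜 := ℝ) M y) := by
    simp [hy, Matrix.toEuclideanCLM_toLp, EuclideanSpace.inner_toLp_toLp, dotProduct_comm]
  have h2 : x ⬝ᵥ x = ‖y‖ * ‖y‖ := by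
    rw [← real_inner_self_eq_norm_mul_norm, hy, EuclideanSpace.inner_toLp_toLp, star_trivial]
  rw [h1, h2]
  calc _ ≤ ‖y‖ * ‖Matrix.toEuclideanCLM (𝕜 := ℝ) M y‖ := abs_real_inner_le_norm _ _
    _ ≤ ‖y‖ * (sNorm M * ‖y‖) := by
      gcongr
      exact ContinuousLinearMap.le_opNorm _ _
    _ = _ := by ring

lemma sNorm_nonneg {n : ℕ} (M : Matrix (Fin n) (Fin n) ℝ) : 0 ≤ sNorm M := norm_nonneg _

lemma sNorm_add_smul_sub_smul_one_le {n : ℕ} (A₀ A₁ : Matrix (Fin n) (Fin n) ℝ) {a b : ℝ}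
    (ha : 0 ≤ a) (hb : 0 ≤ b) :
    sNorm ((A₀ + a • A₁) - b • (1 : Matrix (Fin n) (Fin n) ℝ)) ≤
      sNorm A₀ + a * sNorm A₁ + b := by
  unfold sNorm
  rw [map_sub, map_add, map_smul, map_smul, map_one]
  refine (norm_sub_le _ _).trans (add_le_add ((norm_add_le _ _).trans ?_) ?_)
  · rw [norm_smul, Real.norm_of_nonneg ha]
  · rw [norm_smul, Real.norm_of_nonneg hb]
    exact mul_le_of_le_one_right hb ContinuousLinearMap.norm_id_le

lemma quadForm_sub_smul_one {n : ℕ} (M : Matrix (Fin n) (Fin n) ℝ) (t : ℝ) (x : Fin n → ℝ) :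
    x ⬝ᵥ ((M - t • (1 : Matrix (Fin n) (Fin n) ℝ)) *ᵥ x) = x ⬝ᵥ (M *ᵥ x) - t * (x ⬝ᵥ x) := by
  simp [sub_mulVec, smul_mulVec, dotProduct_sub, dotProduct_smul]

lemma le_quadForm_of_le_lambdaMin {n : ℕ} {M : Matrix (Fin n) (Fin n) ℝ} (hM : M.IsSymm)
    {s : ℝ} (hs : 0 < s) (h : s ≤ lambdaMin M) (x : Fin n → ℝ) :
    s * (x ⬝ᵥ x) ≤ x ⬝ᵥ (M *ᵥ x) := by
  have hne : {t : ℝ | (M - t • (1 : Matrix (Fin n) (Fin n) ℝ)).PosSemidef}.Nonempty := by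
    by_contra hcon
    rw [Set.not_nonempty_iff_eq_empty] at hcon
    simp only [lambdaMin, hcon, Real.sSup_empty] at h
    linarith
  have hN : 0 ≤ x ⬝ᵥ x := by simpa using dotProduct_star_self_nonneg x
  rcases hN.eq_or_lt with h0 | hN
  · have := abs_quadForm_le M x
    rw [← h0, mul_zero] at this
    rw [← h0, mul_zero, abs_nonpos_iff.mp this]
  refine le_of_forall_lt fun c hc => ?_
  obtain ⟨t, ht, hlt⟩ := exists_lt_of_lt_csSup hne
    (lt_of_lt_of_le ((div_lt_iff₀ hN).mpr hc) h)
  have h1 := (posSemidef_iff_quadForm (hM.sub (isSymm_one.smul t))).mp ht x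
  rw [quadForm_sub_smul_one] at h1
  rw [div_lt_iff₀ hN] at hlt
  linarith

lemma lambdaMin_bounds {n : ℕ} {M : Matrix (Fin n) (Fin n) ℝ} (hM : M.IsSymm)
    {s : ℝ} (hs : ∀ x : Fin n → ℝ, s * (x ⬝ᵥ x) ≤ x ⬝ᵥ (M *ᵥ x))
    {v : Fin n → ℝ} (hv : v ⬝ᵥ v = 1) :
    s ≤ lambdaMin M ∧ lambdaMin M ≤ v ⬝ᵥ (M *ᵥ v) := by
  have hub : v ⬝ᵥ (M *ᵥ v) ∈
      upperBounds {t : ℝ | (M - t • (1 : Matrix (Fin n) (Fin n) ℝ)).PosSemidef} := by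
    intro t ht
    have h1 := (posSemidef_iff_quadForm (hM.sub (isSymm_one.smul t))).mp ht v
    rw [quadForm_sub_smul_one, hv] at h1
    linarith
  have hmem : s ∈ {t : ℝ | (M - t • (1 : Matrix (Fin n) (Fin n) ℝ)).PosSemidef} := by
    refine (posSemidef_iff_quadForm (hM.sub (isSymm_one.smul s))).mpr fun x => ?_
    rw [quadForm_sub_smul_one]
    linarith [hs x]
  exact ⟨le_csSup ⟨_, hub⟩ hmem, csSup_le ⟨s, hmem⟩ hub⟩

/-- Guarantee for the generalized-eigenvalue-based replacement of
`ApproxGammaLeft`: with `γ̃ = γ̂ + 1/λ̃`, one has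
`μ/2 ≤ λ_min(A₀ + γ̃A₁) ≤ ṽᵀ(A₀ + γ̃A₁)ṽ ≤ μ`. -/
theorem stmt_19 {n : ℕ}
    (A₀ A₁ : Matrix (Fin n) (Fin n) ℝ) (hA₀s : A₀.IsSymm) (hA₁s : A₁.IsSymm)
    (hA₀n : sNorm A₀ ≤ 1) (hA₁n : sNorm A₁ ≤ 1)
    (ξ ζ γhat μ δ : ℝ)
    (hξ0 : 0 < ξ) (hξ1 : ξ ≤ 1) (hζ : 1 ≤ ζ)
    (hγhat0 : 0 ≤ γhat) (hγhatζ : γhat ≤ ζ)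
    (hAγhat : ((A₀ + γhat • A₁) - ξ • (1 : Matrix (Fin n) (Fin n) ℝ)).PosSemidef)
    (hμ0 : 0 < μ) (hμξ : μ < ξ)
    (hδ : δ = μ * ξ ^ 2 / (360 * ζ ^ 3))
    (Ahat : Matrix (Fin n) (Fin n) ℝ)
    (hAhat : Ahat = (A₀ + γhat • A₁) - (3 * μ / 4) • (1 : Matrix (Fin n) (Fin n) ℝ))
    (B C : Matrix (Fin n) (Fin n) ℝ) (hBs : B.IsSymm) (hCs : C.IsSymm)
    (hBn : sNorm B ≤ δ * sNorm A₁) (hCn : sNorm C ≤ δ * sNorm Ahat)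
    (lam : ℝ) (hlam : IsGreatest {t : ℝ | (-A₁ - t • Ahat).PosSemidef} lam)
    (hlam0 : lam ≠ 0) (hlamζ : 1 / ζ ≤ |lam|)
    (hlmin : lambdaMin (A₀ + (γhat + 1 / lam) • A₁) = 3 * μ / 4)
    (lamt : ℝ)
    (hlamt : IsGreatest {t : ℝ | ((-A₁ + B) - t • (Ahat + C)).PosSemidef} lamt)
    (hlamt0 : lamt ≠ 0)
    (vt : Fin n → ℝ) (hvt : eNorm vt = 1)
    (heig : (-A₁ + B) *ᵥ vt = lamt • ((Ahat + C) *ᵥ vt)) :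
    μ / 2 ≤ lambdaMin (A₀ + (γhat + 1 / lamt) • A₁) ∧
    lambdaMin (A₀ + (γhat + 1 / lamt) • A₁) ≤
      vt ⬝ᵥ ((A₀ + (γhat + 1 / lamt) • A₁) *ᵥ vt) ∧
    vt ⬝ᵥ ((A₀ + (γhat + 1 / lamt) • A₁) *ᵥ vt) ≤ μ := by
  have hv : vt ⬝ᵥ vt = 1 := by
    unfold eNorm at hvt
    exact Real.sqrt_eq_one.mp hvt
  have hζ0 : 0 < ζ := by linarith
  have hδ0 : 0 < δ := by rw [hδ]; positivity
  have hδζ : δ * ζ ^ 2 * 360 ≤ μ * ξ ^ 2 := by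
    have h1 : δ * ζ ^ 2 * 360 * ζ = μ * ξ ^ 2 := by rw [hδ]; field_simp
    nlinarith [show 0 < δ * ζ ^ 2 * 360 by positivity]
  have hδζ' : δ * ζ * 360 ≤ μ * ξ ^ 2 := by
    nlinarith [mul_nonneg (mul_nonneg hδ0.le hζ0.le) (sub_nonneg.mpr hζ)]
  have hξμ : μ * ξ ^ 2 ≤ μ := mul_le_of_le_one_right hμ0.le (pow_le_one₀ hξ0.le hξ1)
  have hμξ2 : μ * ξ ^ 2 ≤ ξ := hξμ.trans hμξ.le
  have hN (x : Fin n → ℝ) : 0 ≤ x ⬝ᵥ x := by simpa using dotProduct_star_self_nonneg x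
  have hAhats : Ahat.IsSymm := by
    rw [hAhat]; exact (hA₀s.add (hA₁s.smul _)).sub (isSymm_one.smul _)
  have hMs (γ : ℝ) : (A₀ + γ • A₁).IsSymm := hA₀s.add (hA₁s.smul _)
  have hS : sNorm Ahat ≤ 3 * ζ := by
    rw [hAhat]
    refine (sNorm_add_smul_sub_smul_one_le A₀ A₁ hγhat0 (by positivity)).trans ?_
    nlinarith [sNorm_nonneg A₁]
  have hp_up (x : Fin n → ℝ) : x ⬝ᵥ (Ahat *ᵥ x) ≤ 3 * ζ * (x ⬝ᵥ x) :=
    (le_abs_self _).trans ((abs_quadForm_le _ _).trans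
      (mul_le_mul_of_nonneg_right hS (hN x)))
  have hp_low (x : Fin n → ℝ) : ξ / 4 * (x ⬝ᵥ x) ≤ x ⬝ᵥ (Ahat *ᵥ x) := by
    have h1 := (posSemidef_iff_quadForm ((hMs γhat).sub (isSymm_one.smul ξ))).mp hAγhat x
    rw [quadForm_sub_smul_one] at h1
    rw [hAhat, quadForm_sub_smul_one]
    nlinarith [hN x]
  have hb (x : Fin n → ℝ) : |x ⬝ᵥ (B *ᵥ x)| ≤ δ * (x ⬝ᵥ x) :=
    (abs_quadForm_le _ _).trans (mul_le_mul_of_nonneg_right (by nlinarith) (hN x))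
  have hc (x : Fin n → ℝ) : |x ⬝ᵥ (C *ᵥ x)| ≤ 3 * (δ * ζ) * (x ⬝ᵥ x) :=
    (abs_quadForm_le _ _).trans (mul_le_mul_of_nonneg_right (by nlinarith) (hN x))
  have hpen (t : ℝ) (x : Fin n → ℝ) : x ⬝ᵥ ((-A₁ - t • Ahat) *ᵥ x) =
      -(x ⬝ᵥ (A₁ *ᵥ x)) - t * (x ⬝ᵥ (Ahat *ᵥ x)) := by
    simp [sub_mulVec, neg_mulVec, smul_mulVec, dotProduct_sub, dotProduct_smul]
  have hpent (t : ℝ) (x : Fin n → ℝ) : x ⬝ᵥ (((-A₁ + B) - t • (Ahat + C)) *ᵥ x) =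
      -(x ⬝ᵥ (A₁ *ᵥ x)) + x ⬝ᵥ (B *ᵥ x) - t * (x ⬝ᵥ (Ahat *ᵥ x) + x ⬝ᵥ (C *ᵥ x)) := by
    simp [sub_mulVec, add_mulVec, neg_mulVec, smul_mulVec, dotProduct_sub, dotProduct_add,
      dotProduct_smul, mul_add]
  have hpens (t : ℝ) : (-A₁ - t • Ahat).IsSymm := hA₁s.neg.sub (hAhats.smul t)
  have hpents (t : ℝ) : ((-A₁ + B) - t • (Ahat + C)).IsSymm :=
    (hA₁s.neg.add hBs).sub ((hAhats.add hCs).smul t)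
  have hA (w : ℝ) (x : Fin n → ℝ) : x ⬝ᵥ ((A₀ + (γhat + w) • A₁) *ᵥ x) =
      x ⬝ᵥ (Ahat *ᵥ x) + 3 * μ / 4 * (x ⬝ᵥ x) + w * (x ⬝ᵥ (A₁ *ᵥ x)) := by
    rw [hAhat, quadForm_sub_smul_one]
    simp only [add_mulVec, smul_mulVec, dotProduct_add, dotProduct_smul, smul_eq_mul]
    ring
  have hlam' (x : Fin n → ℝ) := (posSemidef_iff_quadForm (hpens lam)).mp hlam.1 x
  have hlamt' (x : Fin n → ℝ) := (posSemidef_iff_quadForm (hpents lamt)).mp hlamt.1 x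
  simp only [hpen] at hlam'
  simp only [hpent] at hlamt'
  have heq : -(vt ⬝ᵥ (A₁ *ᵥ vt)) + vt ⬝ᵥ (B *ᵥ vt) =
      lamt * (vt ⬝ᵥ (Ahat *ᵥ vt) + vt ⬝ᵥ (C *ᵥ vt)) := by
    simpa [add_mulVec, neg_mulVec, dotProduct_add, dotProduct_smul, mul_add] using
      congrArg (fun y => vt ⬝ᵥ y) heig
  obtain ⟨w, hw⟩ : ∃ w, w = 1 / lamt := ⟨_, rfl⟩
  have hwl : w * lamt = 1 := by rw [hw]; field_simp
  rw [← hw]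
  -- On the eigenvector, the value of the form is `3μ/4` up to the perturbation.
  have hveq : vt ⬝ᵥ (Ahat *ᵥ vt) + w * (vt ⬝ᵥ (A₁ *ᵥ vt)) =
      w * (vt ⬝ᵥ (B *ᵥ vt)) - vt ⬝ᵥ (C *ᵥ vt) := by
    linear_combination (-(vt ⬝ᵥ (Ahat *ᵥ vt)) - vt ⬝ᵥ (C *ᵥ vt)) * hwl - w * heq
  suffices h : |w| ≤ 2 * ζ ∧ ∀ x : Fin n → ℝ,
      -(μ / 4) * (x ⬝ᵥ x) ≤ x ⬝ᵥ (Ahat *ᵥ x) + w * (x ⬝ᵥ (A₁ *ᵥ x)) by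
    obtain ⟨hwζ, h⟩ := h
    have hbd := lambdaMin_bounds (hMs (γhat + w)) (s := μ / 2)
      (fun x => by rw [hA]; linarith [h x]) hv
    refine ⟨hbd.1, hbd.2, ?_⟩
    have h1 : |w * (vt ⬝ᵥ (B *ᵥ vt))| ≤ 2 * ζ * (δ * (vt ⬝ᵥ vt)) := by
      rw [abs_mul]
      exact mul_le_mul hwζ (hb vt) (abs_nonneg _) (by positivity)
    have h2 := le_of_abs_le h1
    have h3 := neg_le_of_abs_le (hc vt)
    rw [hv] at h2 h3
    rw [hA, hv]
    linarith
  rcases lt_or_gt_of_ne hlam0 with hneg | hpos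
  · rw [abs_of_neg hneg] at hlamζ
    have hlt : lamt ≤ -(1 / (2 * ζ)) := by
      by_contra! hcon
      have hζi : 0 < 1 / ζ := by positivity
      have hnot : ¬ (-A₁ - (-(9 / 10 * (1 / ζ))) • Ahat).PosSemidef := fun hmem => by
        have := hlam.2 hmem
        linarith
      rw [posSemidef_iff_quadForm (hpens _)] at hnot
      push Not at hnot
      obtain ⟨x, hx⟩ := hnot
      rw [hpen] at hx
      have h1 := hlamt' x
      have hpl := hp_low x
      have hb2 := le_of_abs_le (hb x)
      have hc1 := neg_le_of_abs_le (hc x)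
      have hc2 := le_of_abs_le (hc x)
      have hNx := hN x
      generalize x ⬝ᵥ x = N at *
      generalize x ⬝ᵥ (Ahat *ᵥ x) = p at *
      generalize x ⬝ᵥ (A₁ *ᵥ x) = a at *
      generalize x ⬝ᵥ (B *ᵥ x) = b at *
      generalize x ⬝ᵥ (C *ᵥ x) = c at *
      have hdN : δ * ζ * N * 360 ≤ ξ * N := by
        have := mul_le_mul_of_nonneg_right (hδζ'.trans hμξ2) hNx
        linarith
      have hξN : 0 ≤ ξ * N := mul_nonneg hξ0.le hNx
      have hpc : 0 ≤ p + c := by linarith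
      have h2 := mul_le_mul_of_nonneg_right hcon.le hpc
      have hhalf : 1 / (2 * ζ) = 1 / 2 * (1 / ζ) := by field_simp
      rw [hhalf] at h2
      have h3 : 0 < b + (1 / ζ) * ((p + c) / 2 - 9 / 10 * p) := by
        linear_combination hx + h1 + h2
      have h4 := mul_pos hζ0 h3
      have h5 : ζ * (b + (1 / ζ) * ((p + c) / 2 - 9 / 10 * p)) =
          ζ * b + ((p + c) / 2 - 9 / 10 * p) := by field_simp
      rw [h5] at h4
      have h6 := mul_le_mul_of_nonneg_left hb2 hζ0.le
      linarith
    have hlt0 : lamt < 0 := lt_of_le_of_lt hlt (by simp; positivity)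
    have hw0 : w < 0 := by rw [hw]; exact one_div_neg.mpr hlt0
    have hwζ : -(2 * ζ) ≤ w := by
      have h1 := mul_le_mul_of_nonpos_left hlt hw0.le
      rw [hwl] at h1
      have h2 : w * -(1 / (2 * ζ)) = -w / (2 * ζ) := by ring
      rw [h2, div_le_one (by positivity)] at h1
      linarith
    refine ⟨by rw [abs_of_neg hw0]; linarith, fun x => ?_⟩
    have h1 := mul_nonpos_of_nonpos_of_nonneg hw0.le (hlamt' x)
    have h2 : |w * (x ⬝ᵥ (B *ᵥ x))| ≤ 2 * ζ * (δ * (x ⬝ᵥ x)) := by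
      rw [abs_mul]
      exact mul_le_mul (by rw [abs_of_neg hw0]; linarith) (hb x) (abs_nonneg _) (by positivity)
    have h3 := neg_le_of_abs_le h2
    have h4 := le_of_abs_le (hc x)
    have h5 : w * (-(x ⬝ᵥ (A₁ *ᵥ x)) + x ⬝ᵥ (B *ᵥ x) -
        lamt * (x ⬝ᵥ (Ahat *ᵥ x) + x ⬝ᵥ (C *ᵥ x))) =
        -(w * (x ⬝ᵥ (A₁ *ᵥ x))) + w * (x ⬝ᵥ (B *ᵥ x)) -
        (x ⬝ᵥ (Ahat *ᵥ x) + x ⬝ᵥ (C *ᵥ x)) := by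
      linear_combination (-(x ⬝ᵥ (Ahat *ᵥ x) + x ⬝ᵥ (C *ᵥ x))) * hwl
    rw [h5] at h1
    have h6 : δ * ζ * 360 * (x ⬝ᵥ x) ≤ μ * (x ⬝ᵥ x) :=
      mul_le_mul_of_nonneg_right (hδζ'.trans hξμ) (hN x)
    linarith [mul_nonneg hμ0.le (hN x)]
  · -- For positive `lam` the hypothesis on `lambdaMin` forces `A₁ = -lam • Ahat`.
    rw [abs_of_pos hpos] at hlamζ
    have hA₁ (x : Fin n → ℝ) : x ⬝ᵥ (A₁ *ᵥ x) = -(lam * (x ⬝ᵥ (Ahat *ᵥ x))) := by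
      have h1 := le_quadForm_of_le_lambdaMin (hMs (γhat + 1 / lam)) (s := 3 * μ / 4)
        (by positivity) hlmin.ge x
      rw [hA] at h1
      have h2 : 0 ≤ x ⬝ᵥ (Ahat *ᵥ x) + 1 / lam * (x ⬝ᵥ (A₁ *ᵥ x)) := by linarith
      have h3 := mul_nonneg hpos.le h2
      have h4 : lam * (x ⬝ᵥ (Ahat *ᵥ x) + 1 / lam * (x ⬝ᵥ (A₁ *ᵥ x))) =
          lam * (x ⬝ᵥ (Ahat *ᵥ x)) + x ⬝ᵥ (A₁ *ᵥ x) := by field_simp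
      rw [h4] at h3
      linarith [hlam' x]
    have hlt : 1 / (2 * ζ) ≤ lamt := by
      refine hlamt.2 ((posSemidef_iff_quadForm (hpents _)).mpr fun x => ?_)
      rw [hpent, hA₁]
      have hpl := hp_low x
      have hb2 := neg_le_of_abs_le (hb x)
      have hc2 := le_of_abs_le (hc x)
      have hNx := hN x
      generalize x ⬝ᵥ x = N at *
      generalize x ⬝ᵥ (Ahat *ᵥ x) = p at *
      generalize x ⬝ᵥ (B *ᵥ x) = b at *
      generalize x ⬝ᵥ (C *ᵥ x) = c at *
      have hdN : δ * ζ * N * 360 ≤ ξ * N := by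
        have := mul_le_mul_of_nonneg_right (hδζ'.trans hμξ2) hNx
        linarith
      have hξN : 0 ≤ ξ * N := mul_nonneg hξ0.le hNx
      have hp0 : 0 ≤ p := le_trans (by positivity) hpl
      have h1 := mul_le_mul_of_nonneg_right hlamζ hp0
      have h2 := mul_le_mul_of_nonneg_left hb2 hζ0.le
      have h3 : 0 ≤ ζ * b + p / 2 - c / 2 := by linarith
      have h4 : (1 / ζ) * (ζ * b + p / 2 - c / 2) = b + 1 / ζ * p - 1 / (2 * ζ) * (p + c) := by
        field_simp; ring
      have h5 : 0 ≤ (1 / ζ) * (ζ * b + p / 2 - c / 2) := mul_nonneg (by positivity) h3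
      linarith
    have hlt0 : 0 < lamt := lt_of_lt_of_le (by positivity) hlt
    have hw0 : 0 < w := by rw [hw]; positivity
    have hwζ : w ≤ 2 * ζ := by
      rw [hw, one_div_le hlt0 (by positivity)]
      exact hlt
    have hwabs : |w| ≤ 2 * ζ := by rwa [abs_of_pos hw0]
    refine ⟨hwabs, fun x => ?_⟩
    have h1 : |w * (vt ⬝ᵥ (B *ᵥ vt))| ≤ 2 * ζ * (δ * (vt ⬝ᵥ vt)) := by
      rw [abs_mul]
      exact mul_le_mul hwabs (hb vt) (abs_nonneg _) (by positivity)
    have h2 := neg_le_of_abs_le h1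
    have h3 := le_of_abs_le (hc vt)
    have hpv := hp_low vt
    rw [hA₁] at hveq ⊢
    rw [hv] at h2 h3 hpv
    have hr : (1 - w * lam) * (vt ⬝ᵥ (Ahat *ᵥ vt)) ≥ -(5 * (δ * ζ)) := by
      linarith
    have hr2 : x ⬝ᵥ (Ahat *ᵥ x) + w * -(lam * (x ⬝ᵥ (Ahat *ᵥ x))) =
        (1 - w * lam) * (x ⬝ᵥ (Ahat *ᵥ x)) := by ring
    rw [hr2]
    generalize 1 - w * lam = r at *
    have hp0 : 0 ≤ x ⬝ᵥ (Ahat *ᵥ x) := le_trans (mul_nonneg (by positivity) (hN x)) (hp_low x)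
    rcases le_or_gt 0 r with hr0 | hr0
    · have := mul_nonneg hr0 hp0
      linarith [mul_nonneg hμ0.le (hN x)]
    · have h4 : -r * ξ ≤ 20 * (δ * ζ) := by
        have := mul_le_mul_of_nonpos_left hpv hr0.le
        linarith
      have h5 : -r * ζ * ξ * 360 ≤ 20 * (μ * ξ ^ 2) := by
        have := mul_le_mul_of_nonneg_right h4 hζ0.le
        linarith
      have h6 : -r * ζ * 18 ≤ μ := by
        have : -r * ζ * 360 ≤ 20 * (μ * ξ) := by
          refine le_of_mul_le_mul_right ?_ hξ0
          linarith
        linarith [mul_le_of_le_one_right hμ0.le hξ1]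
      have h7 := mul_le_mul_of_nonpos_left (hp_up x) hr0.le
      have h8 := mul_le_mul_of_nonneg_right h6 (hN x)
      linarith [mul_nonneg hμ0.le (hN x)]
end
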